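/- Let F be a p-adic local field with p ≥ 3 odd residue characteristic, and let E be an elliptic curve over F that becomes semistable (good or multiplicative reduction) over some quadratic extension of F. Then E itself is semistable over F, or the quadratic twist of E by a uniformizer of F is semistable over F. -/

import Mathlib

noncomputable section

open WeierstrassCurve WeierstrassCurve.Affine Polynomial Matrix

/-- `v : F → ℤ` is a normalized (i.e. surjective) discrete valuation of the field `F`. -/
structure IsNormalizedValuation {F : Type} [Field F] (v : F → ℤ) : Prop where
  map_mul : ∀ ⦃x y : F⦄, x ≠ 0 → y ≠ 0 → v (x * y) = v x + v y
  min_le_add : ∀ ⦃x y : F⦄, x ≠ 0 → y ≠ 0 → x + y ≠ 0 → min (v x) (v y) ≤ v (x + y)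
  exists_uniformizer : ∃ π : F, π ≠ 0 ∧ v π = 1

/-- `x` is integral with respect to the valuation `v`. -/
def VIntegral {F : Type} [Field F] (v : F → ℤ) (x : F) : Prop := x = 0 ∨ 0 ≤ v x

/-- `W` is a Weierstrass model of `E`, i.e. it is obtained from `E` by a change of variables. -/
def IsModelOf {F : Type} [Field F] (E W : WeierstrassCurve F) : Prop :=
  ∃ C : WeierstrassCurve.VariableChange F, C • E = W

/-- A Weierstrass model is integral if all its coefficients are `v`-integral. -/
def IsIntegralModel {F : Type} [Field F] (v : F → ℤ) (W : WeierstrassCurve F) : Prop :=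
  VIntegral v W.a₁ ∧ VIntegral v W.a₂ ∧ VIntegral v W.a₃ ∧ VIntegral v W.a₄ ∧ VIntegral v W.a₆

/-- A minimal integral Weierstrass model of `E` at `v`. -/
def IsMinimalModel {F : Type} [Field F] (v : F → ℤ) (E W : WeierstrassCurve F) : Prop :=
  IsModelOf E W ∧ IsIntegralModel v W ∧
    ∀ W' : WeierstrassCurve F, IsModelOf E W' → IsIntegralModel v W' → v W.Δ ≤ v W'.Δ

/-- `E` has good reduction at `v`: a minimal model has unit discriminant. -/
def HasGoodReduction {F : Type} [Field F] (v : F → ℤ) (E : WeierstrassCurve F) : Prop :=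
  ∃ W, IsMinimalModel v E W ∧ v W.Δ = 0

/-- `E` has (bad) multiplicative reduction at `v`. -/
def HasMultiplicativeReduction {F : Type} [Field F] (v : F → ℤ) (E : WeierstrassCurve F) : Prop :=
  ∃ W, IsMinimalModel v E W ∧ 0 < v W.Δ ∧ W.c₄ ≠ 0 ∧ v W.c₄ = 0

/-- `E` has additive reduction at `v`. -/
def HasAdditiveReduction {F : Type} [Field F] (v : F → ℤ) (E : WeierstrassCurve F) : Prop :=
  ∃ W, IsMinimalModel v E W ∧ 0 < v W.Δ ∧ (W.c₄ = 0 ∨ 0 < v W.c₄)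

/-- `E` is semistable at `v`: it has good or multiplicative reduction. -/
def IsSemistable {F : Type} [Field F] (v : F → ℤ) (E : WeierstrassCurve F) : Prop :=
  HasGoodReduction v E ∨ HasMultiplicativeReduction v E

/-- The short Weierstrass curve `y² = x³ + Ax + B`. -/
def shortCurve {F : Type} [Field F] (A B : F) : WeierstrassCurve F :=
  { a₁ := 0, a₂ := 0, a₃ := 0, a₄ := A, a₆ := B }

/-- The Hasse invariant of the curve `y² = x³ + Ax + B` in residue characteristic `p`: the
coefficient of `x^(p-1)` in `(x³ + Ax + B)^((p-1)/2)`. Its reduction modulo the maximal ideal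
vanishes if and only if the reduction of the curve is supersingular. -/
def hasseCoeff {F : Type} [Field F] (p : ℕ) (A B : F) : F :=
  (((X : F[X]) ^ 3 + C A * X + C B) ^ ((p - 1) / 2)).coeff (p - 1)

/-- `E` has good ordinary reduction at `v` (`p ≥ 5` the residue characteristic). -/
def HasGoodOrdinaryReduction {F : Type} [Field F] (v : F → ℤ) (p : ℕ)
    (E : WeierstrassCurve F) : Prop :=
  ∃ A B : F, IsModelOf E (shortCurve A B) ∧ VIntegral v A ∧ VIntegral v B ∧
    v (shortCurve A B).Δ = 0 ∧ hasseCoeff p A B ≠ 0 ∧ v (hasseCoeff p A B) = 0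

/-- `E` has good supersingular reduction at `v` (`p ≥ 5` the residue characteristic). -/
def HasGoodSupersingularReduction {F : Type} [Field F] (v : F → ℤ) (p : ℕ)
    (E : WeierstrassCurve F) : Prop :=
  ∃ A B : F, IsModelOf E (shortCurve A B) ∧ VIntegral v A ∧ VIntegral v B ∧
    v (shortCurve A B).Δ = 0 ∧ (hasseCoeff p A B = 0 ∨ 0 < v (hasseCoeff p A B))

/-- `w` is an extension of the valuation `v` (with some ramification index `e`). -/
def ValExtends {F L : Type} [Field F] [Field L] [Algebra F L] (v : F → ℤ) (w : L → ℤ) : Prop :=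
  ∃ e : ℕ, 0 < e ∧ ∀ x : F, x ≠ 0 → w (algebraMap F L x) = e * v x

/-- `E` has potential good reduction at `v`: it acquires good reduction over some finite
extension. -/
def HasPotentialGoodReduction {F : Type} [Field F] (v : F → ℤ) (E : WeierstrassCurve F) : Prop :=
  ∃ (L : Type) (_ : Field L) (_ : Algebra F L) (_ : FiniteDimensional F L) (w : L → ℤ),
    IsNormalizedValuation w ∧ ValExtends v w ∧ HasGoodReduction w (E.baseChange L)

/-- `E` has potential multiplicative reduction at `v`: it acquires multiplicative reduction over
some finite extension. -/
def HasPotentialMultiplicativeReduction {F : Type} [Field F] (v : F → ℤ)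
    (E : WeierstrassCurve F) : Prop :=
  ∃ (L : Type) (_ : Field L) (_ : Algebra F L) (_ : FiniteDimensional F L) (w : L → ℤ),
    IsNormalizedValuation w ∧ ValExtends v w ∧ HasMultiplicativeReduction w (E.baseChange L)

/-- `E` has potential good ordinary reduction at `v`: it acquires good ordinary reduction over
some finite extension. -/
def HasPotentialGoodOrdinaryReduction {F : Type} [Field F] (v : F → ℤ) (p : ℕ)
    (E : WeierstrassCurve F) : Prop :=
  ∃ (L : Type) (_ : Field L) (_ : Algebra F L) (_ : FiniteDimensional F L) (w : L → ℤ),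
    IsNormalizedValuation w ∧ ValExtends v w ∧ HasGoodOrdinaryReduction w p (E.baseChange L)

/-- `E` has potential good supersingular reduction at `v`: it acquires good supersingular
reduction over some finite extension. -/
def HasPotentialGoodSupersingularReduction {F : Type} [Field F] (v : F → ℤ) (p : ℕ)
    (E : WeierstrassCurve F) : Prop :=
  ∃ (L : Type) (_ : Field L) (_ : Algebra F L) (_ : FiniteDimensional F L) (w : L → ℤ),
    IsNormalizedValuation w ∧ ValExtends v w ∧ HasGoodSupersingularReduction w p (E.baseChange L)

/-- `E` admits the short Weierstrass model `y² = x³ + Ax + B`. -/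
def IsShortModelOf {F : Type} [Field F] (E : WeierstrassCurve F) (A B : F) : Prop :=
  IsModelOf E (shortCurve A B)

/-- `E'` is the quadratic twist of `E` by `d`: some short model `y² = x³ + Ax + B` of `E` has
twisted model `y² = x³ + d²Ax + d³B` for `E'`. -/
def IsQuadraticTwistOf {F : Type} [Field F] (E' E : WeierstrassCurve F) (d : F) : Prop :=
  ∃ A B : F, IsShortModelOf E A B ∧ IsShortModelOf E' (d ^ 2 * A) (d ^ 3 * B)

/-- `x` vanishes or has valuation at least `n`. -/
def ValGE {F : Type} [Field F] (v : F → ℤ) (n : ℤ) (x : F) : Prop := x = 0 ∨ n ≤ v x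

namespace IsNormalizedValuation

variable {F : Type} [Field F] {v : F → ℤ}

lemma map_one (hv : IsNormalizedValuation v) : v 1 = 0 := by
  have h := hv.map_mul (one_ne_zero (α := F)) one_ne_zero
  rw [mul_one] at h
  omega

lemma map_pow (hv : IsNormalizedValuation v) {x : F} (hx : x ≠ 0) (n : ℕ) :
    v (x ^ n) = n * v x := by
  induction n with
  | zero => simp [hv.map_one]
  | succ n ih =>
    rw [pow_succ, hv.map_mul (pow_ne_zero n hx) hx, ih]
    push_cast
    ring

lemma map_neg (hv : IsNormalizedValuation v) {x : F} (hx : x ≠ 0) : v (-x) = v x := by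
  have h1 : v (-1) = 0 := by
    have h := hv.map_pow (neg_ne_zero.2 (one_ne_zero (α := F))) 2
    rw [neg_one_sq, hv.map_one] at h
    push_cast at h
    omega
  rw [neg_eq_neg_one_mul, hv.map_mul (neg_ne_zero.2 one_ne_zero) hx, h1, zero_add]

lemma map_inv (hv : IsNormalizedValuation v) {x : F} (hx : x ≠ 0) : v x⁻¹ = -v x := by
  have h := hv.map_mul hx (inv_ne_zero hx)
  rw [mul_inv_cancel₀ hx, hv.map_one] at h
  omega

lemma map_div (hv : IsNormalizedValuation v) {x y : F} (hx : x ≠ 0) (hy : y ≠ 0) :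
    v (x / y) = v x - v y := by
  rw [div_eq_mul_inv, hv.map_mul hx (inv_ne_zero hy), hv.map_inv hy, sub_eq_add_neg]

lemma exists_eq (hv : IsNormalizedValuation v) (n : ℤ) : ∃ x : F, x ≠ 0 ∧ v x = n := by
  obtain ⟨π, hπ, h1⟩ := hv.exists_uniformizer
  rcases Int.eq_nat_or_neg n with ⟨k, rfl | rfl⟩
  · exact ⟨π ^ k, pow_ne_zero k hπ, by rw [hv.map_pow hπ, h1, mul_one]⟩
  · exact ⟨(π ^ k)⁻¹, inv_ne_zero (pow_ne_zero k hπ), by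
      rw [hv.map_inv (pow_ne_zero k hπ), hv.map_pow hπ, h1, mul_one]⟩

lemma valGE_add (hv : IsNormalizedValuation v) {n : ℤ} {x y : F} (hx : ValGE v n x)
    (hy : ValGE v n y) : ValGE v n (x + y) := by
  by_cases hx0 : x = 0
  · simpa [hx0] using hy
  by_cases hy0 : y = 0
  · simpa [hy0] using hx
  by_cases hxy : x + y = 0
  · exact Or.inl hxy
  · have h := hv.min_le_add hx0 hy0 hxy
    exact Or.inr ((le_min (hx.resolve_left hx0) (hy.resolve_left hy0)).trans h)

lemma valGE_mul (hv : IsNormalizedValuation v) {m n : ℤ} {x y : F} (hx : ValGE v m x)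
    (hy : ValGE v n y) : ValGE v (m + n) (x * y) := by
  by_cases hx0 : x = 0
  · exact Or.inl (by simp [hx0])
  by_cases hy0 : y = 0
  · exact Or.inl (by simp [hy0])
  · have h1 := hx.resolve_left hx0
    have h2 := hy.resolve_left hy0
    exact Or.inr (by rw [hv.map_mul hx0 hy0]; omega)

lemma valGE_neg (hv : IsNormalizedValuation v) {n : ℤ} {x : F} (hx : ValGE v n x) :
    ValGE v n (-x) := by
  by_cases hx0 : x = 0
  · exact Or.inl (by simp [hx0])
  · exact Or.inr (by rw [hv.map_neg hx0]; exact hx.resolve_left hx0)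

/-- The valuation ring of `v`. -/
def integers (hv : IsNormalizedValuation v) : Subring F where
  carrier := {x | VIntegral v x}
  mul_mem' hx hy := hv.valGE_mul (m := 0) (n := 0) hx hy
  one_mem' := Or.inr hv.map_one.ge
  add_mem' hx hy := hv.valGE_add hx hy
  zero_mem' := Or.inl rfl
  neg_mem' hx := hv.valGE_neg hx

lemma mem_integers (hv : IsNormalizedValuation v) {x : F} : x ∈ hv.integers ↔ VIntegral v x :=
  Iff.rfl

lemma natCast_mem_integers (hv : IsNormalizedValuation v) (n : ℕ) : (n : F) ∈ hv.integers :=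
  natCast_mem _ n

lemma not_valGE_one (hv : IsNormalizedValuation v) {n : ℤ} (hn : 0 < n) : ¬ ValGE v n (1 : F) := by
  rintro (h | h)
  · exact one_ne_zero h
  · rw [hv.map_one] at h
    omega

/-- An element that is close to `x` has the same valuation as `x`. -/
lemma map_eq_of_valGE_sub (hv : IsNormalizedValuation v) {x y : F} (hx : x ≠ 0)
    (h : ValGE v (v x + 1) (y - x)) : y ≠ 0 ∧ v y = v x := by
  have hy : y ≠ 0 := by
    rintro rfl
    rw [zero_sub] at h
    have h2 := h.resolve_left (neg_ne_zero.2 hx)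
    rw [hv.map_neg hx] at h2
    omega
  refine ⟨hy, le_antisymm ?_ ?_⟩
  · by_contra hlt
    have h1 : ValGE v (v x + 1) y := Or.inr (by omega)
    have h2 := hv.valGE_add h1 (hv.valGE_neg h)
    rw [show y + -(y - x) = x by ring] at h2
    have h3 := h2.resolve_left hx
    omega
  · have h1 : ValGE v (v x) (y - x) := h.imp_right (by omega)
    have h2 := hv.valGE_add h1 (Or.inr le_rfl : ValGE v (v x) x)
    rw [sub_add_cancel] at h2
    exact h2.resolve_left hy

lemma map_two (hv : IsNormalizedValuation v) [CharZero F] {p : ℕ} (hp : Odd p)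
    (hres : 0 < v (p : F)) : v 2 = 0 := by
  have h2 : (2 : F) ≠ 0 := two_ne_zero
  have hge : 0 ≤ v 2 := (hv.natCast_mem_integers 2).resolve_left (by simp)
  by_contra hne
  obtain ⟨k, rfl⟩ := hp
  have h1 : ValGE v 1 ((2 * k + 1 : ℕ) : F) := Or.inr hres
  have h3 : ValGE v 1 (2 * (k : F)) := by
    simpa using hv.valGE_mul (Or.inr (by omega) : ValGE v 1 (2 : F)) (hv.natCast_mem_integers k)
  have h4 := hv.valGE_add h1 (hv.valGE_neg h3)
  rw [show ((2 * k + 1 : ℕ) : F) + -(2 * (k : F)) = 1 by push_cast; ring] at h4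
  exact hv.not_valGE_one one_pos h4

/-- The valuation ring is closed under roots of monic cubic polynomials. -/
lemma mem_integers_of_cubic (hv : IsNormalizedValuation v) {a b c x : F}
    (ha : a ∈ hv.integers) (hb : b ∈ hv.integers) (hc : c ∈ hv.integers)
    (h : x ^ 3 + a * x ^ 2 + b * x = c) : x ∈ hv.integers := by
  by_contra hx
  have hx0 : x ≠ 0 := by
    rintro rfl
    exact hx (zero_mem _)
  have hneg : v x < 0 := by
    by_contra h0
    exact hx (Or.inr (by omega))
  have hy : ValGE v 1 x⁻¹ := Or.inr (by rw [hv.map_inv hx0]; omega)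
  have hyi : x⁻¹ ∈ hv.integers := hy.imp_right (by omega)
  have hz : c * x⁻¹ ^ 2 - a - b * x⁻¹ ∈ hv.integers :=
    sub_mem (sub_mem (mul_mem hc (pow_mem hyi 2)) ha) (mul_mem hb hyi)
  have h1 := hv.valGE_mul hy hz
  have h2 : x⁻¹ * (c * x⁻¹ ^ 2 - a - b * x⁻¹) = 1 := by
    rw [← h]
    field_simp
    ring
  rw [h2, add_zero] at h1
  exact hv.not_valGE_one one_pos h1

lemma comp_ringEquiv {L : Type} [Field L] {w : L → ℤ} (hw : IsNormalizedValuation w)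
    (σ : L ≃+* L) : IsNormalizedValuation (fun x ↦ w (σ x)) where
  map_mul x y hx hy := by
    simp only [_root_.map_mul]
    exact hw.map_mul (by simpa using hx) (by simpa using hy)
  min_le_add x y hx hy hxy := by
    simp only [map_add]
    exact hw.min_le_add (by simpa using hx) (by simpa using hy) (by
      rwa [← map_add, ne_eq, EmbeddingLike.map_eq_zero_iff])
  exists_uniformizer := by
    obtain ⟨π, hπ, h⟩ := hw.exists_uniformizer
    exact ⟨σ.symm π, by simpa using hπ, by simpa using h⟩

/-- A normalized valuation is determined by its valuation ring. -/
lemma eq_of_nonneg (hv : IsNormalizedValuation v) {v' : F → ℤ} (hv' : IsNormalizedValuation v')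
    (h : ∀ x, x ≠ 0 → 0 ≤ v x → 0 ≤ v' x) {x : F} (hx : x ≠ 0) : v' x = v x := by
  have h0 : ∀ y, y ≠ 0 → v y = 0 → v' y = 0 := fun y hy hvy ↦ by
    have h1 := h y hy hvy.ge
    have h2 := h y⁻¹ (inv_ne_zero hy) (by rw [hv.map_inv hy]; omega)
    rw [hv'.map_inv hy] at h2
    omega
  obtain ⟨π, hπ, hπ1⟩ := hv.exists_uniformizer
  have key : ∀ y, y ≠ 0 → v' y = v y * v' π := fun y hy ↦ by
    obtain ⟨k, hk | hk⟩ := Int.eq_nat_or_neg (v y)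
    · have h1 := h0 (y / π ^ k) (div_ne_zero hy (pow_ne_zero k hπ)) (by
        rw [hv.map_div hy (pow_ne_zero k hπ), hv.map_pow hπ, hπ1]; omega)
      rw [hv'.map_div hy (pow_ne_zero k hπ), hv'.map_pow hπ] at h1
      rw [hk]
      omega
    · have h1 := h0 (y * π ^ k) (mul_ne_zero hy (pow_ne_zero k hπ)) (by
        rw [hv.map_mul hy (pow_ne_zero k hπ), hv.map_pow hπ, hπ1]; omega)
      rw [hv'.map_mul hy (pow_ne_zero k hπ), hv'.map_pow hπ] at h1
      rw [hk]
      linarith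
  obtain ⟨π', hπ', h1⟩ := hv'.exists_uniformizer
  have h2 := key π' hπ'
  rw [h1] at h2
  have h3 := h π hπ (by omega)
  have h4 : v' π = 1 := Int.eq_one_of_mul_eq_one_left h3 h2.symm
  rw [key x hx, h4, mul_one]

end IsNormalizedValuation

section Quadratic

variable {F L : Type} [Field F] [Field L] [Algebra F L] {w : L → ℤ}

/-- If the involution `σ` moves the valuation `w`, then the fixed field of `σ` is dense. -/
lemma exists_valGE_sub_of_map_ne (hw : IsNormalizedValuation w) (σ : L ≃ₐ[F] L)
    (hσ : ∀ x, σ (σ x) = x) (hfix : ∀ x, σ x = x → x ∈ Set.range (algebraMap F L))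
    (hne : ∃ x, x ≠ 0 ∧ w (σ x) ≠ w x) (z : L) (N : ℤ) :
    ∃ z₀ : F, ValGE w N (algebraMap F L z₀ - z) := by
  obtain ⟨x, hx0, hpos, hneg⟩ : ∃ x, x ≠ 0 ∧ 0 < w x ∧ w (σ x) < 0 := by
    by_contra! hcon
    obtain ⟨x, hx, hxne⟩ := hne
    refine hxne (hw.eq_of_nonneg (hw.comp_ringEquiv (σ : L ≃+* L)) (fun y hy hwy ↦ ?_) hx)
    by_contra! hlt
    have hlt' : w (σ y) < 0 := hlt
    have hσy : σ y ≠ 0 := by simpa using hy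
    have h1 := hcon (y / σ y) (div_ne_zero hy hσy) (by rw [hw.map_div hy hσy]; omega)
    rw [map_div₀, hσ, hw.map_div hσy hy] at h1
    omega
  by_cases hz : z = 0
  · exact ⟨0, Or.inl (by simp [hz])⟩
  have hσz : σ z ≠ 0 := by simpa using hz
  have hσx : σ x ≠ 0 := by simpa using hx0
  obtain ⟨n, hn0, hn1, hn2⟩ : ∃ n : ℕ, 0 < n ∧ N ≤ n + w z ∧ N ≤ n + w (σ z) :=
    ⟨((N - w z) ⊔ (N - w (σ z)) ⊔ 1).toNat, by omega, by omega, by omega⟩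
  have hn0' : (0 : ℤ) < n := by exact_mod_cast hn0
  obtain ⟨ha0, ha⟩ := hw.map_eq_of_valGE_sub (x := 1) (y := 1 + x ^ n) one_ne_zero (by
    refine Or.inr ?_
    rw [add_sub_cancel_left, hw.map_one, hw.map_pow hx0]
    nlinarith)
  rw [hw.map_one] at ha
  obtain ⟨hb0, hb⟩ := hw.map_eq_of_valGE_sub (x := σ x ^ n) (y := 1 + σ x ^ n)
    (pow_ne_zero n hσx) (by
    refine Or.inr ?_
    rw [add_sub_cancel_right, hw.map_one, hw.map_pow hσx]
    nlinarith)
  rw [hw.map_pow hσx] at hb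
  obtain ⟨z₀, hz₀⟩ := hfix (z / (1 + x ^ n) + σ z / (1 + σ x ^ n)) (by
    simp only [map_add, map_div₀, map_pow, map_one, hσ]
    ring)
  refine ⟨z₀, ?_⟩
  have heq : algebraMap F L z₀ - z =
      -(x ^ n * z / (1 + x ^ n)) + σ z / (1 + σ x ^ n) := by
    rw [hz₀]
    field_simp
    ring
  rw [heq]
  refine hw.valGE_add (hw.valGE_neg (Or.inr ?_)) (Or.inr ?_)
  · rw [hw.map_div (mul_ne_zero (pow_ne_zero n hx0) hz) ha0,
      hw.map_mul (pow_ne_zero n hx0) hz, hw.map_pow hx0, ha]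
    nlinarith
  · rw [hw.map_div hσz hb0, hb]
    nlinarith

/-- A translation by `r` and a scaling by `u ^ 2` which make the cubic `x ^ 3 + A * x + B` integral
can be replaced by ones that are defined over the base field. -/
lemma exists_descended_change (hw : IsNormalizedValuation w) (hw2 : w 2 = 0) (h20 : (2 : L) ≠ 0)
    (σ : L ≃ₐ[F] L)
    (hσ : ∀ x, σ (σ x) = x) (hfix : ∀ x, σ x = x → x ∈ Set.range (algebraMap F L))
    (A B : F) {r u : L} (hu : u ≠ 0) (h2 : 3 * r / u ^ 2 ∈ hw.integers)
    (h4 : (algebraMap F L A + 3 * r ^ 2) / u ^ 4 ∈ hw.integers)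
    (h6 : (r ^ 3 + algebraMap F L A * r + algebraMap F L B) / u ^ 6 ∈ hw.integers) :
    ∃ r₀ D : F, D ≠ 0 ∧ w (algebraMap F L D) = 2 * w u ∧
      (algebraMap F L r₀ - r) / u ^ 2 ∈ hw.integers := by
  have hu2 : u ^ 2 ≠ 0 := pow_ne_zero 2 hu
  have hwu2 : w (u ^ 2) = 2 * w u := by rw [hw.map_pow hu]; rfl
  by_cases hne : ∃ x, x ≠ 0 ∧ w (σ x) ≠ w x
  · obtain ⟨r₀, hr₀⟩ := exists_valGE_sub_of_map_ne hw σ hσ hfix hne r (w (u ^ 2))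
    obtain ⟨D, hD⟩ := exists_valGE_sub_of_map_ne hw σ hσ hfix hne (u ^ 2) (w (u ^ 2) + 1)
    obtain ⟨hD0, hDw⟩ := hw.map_eq_of_valGE_sub hu2 hD
    refine ⟨r₀, D, by simpa using hD0, by rw [hDw, hwu2], ?_⟩
    have h := hw.valGE_mul hr₀ (Or.inr (hw.map_inv hu2).ge : ValGE w (-w (u ^ 2)) (u ^ 2)⁻¹)
    rwa [add_neg_cancel, ← div_eq_mul_inv] at h
  · push Not at hne
    have hσu : σ u ≠ 0 := by simpa using hu
    have hσint : ∀ {x : L}, x ∈ hw.integers → σ x ∈ hw.integers := fun {x} hx ↦ by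
      by_cases hx0 : x = 0
      · simp [hx0]
      · exact Or.inr (by rw [hne x hx0]; exact hx.resolve_left hx0)
    obtain ⟨r₀, hr₀⟩ := hfix ((r + σ r) / 2) (by
      simp only [map_div₀, map_add, hσ, map_ofNat]
      ring)
    obtain ⟨D, hD⟩ := hfix (u * σ u) (by
      simp only [map_mul, hσ]
      ring)
    have hD0 : algebraMap F L D ≠ 0 := by
      rw [hD]
      exact mul_ne_zero hu hσu
    refine ⟨r₀, D, by simpa using hD0, by rw [hD, hw.map_mul hu hσu, hne u hu]; ring, ?_⟩
    have hunit : σ u / u ∈ hw.integers :=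
      Or.inr (by rw [hw.map_div hσu hu, hne u hu, sub_self])
    have hhalf : (2 : L)⁻¹ ∈ hw.integers := Or.inr (by rw [hw.map_inv h20, hw2, neg_zero])
    have hρ : (σ r - r) / u ^ 2 ∈ hw.integers := by
      have h6' := mul_mem (hσint h6) (pow_mem hunit 6)
      refine hw.mem_integers_of_cubic h2 h4 (sub_mem h6' h6) ?_
      simp only [map_div₀, map_add, map_mul, map_pow, AlgEquiv.commutes]
      field_simp
      ring
    have heq : (algebraMap F L r₀ - r) / u ^ 2 = (σ r - r) / u ^ 2 * 2⁻¹ := by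
      rw [hr₀]
      field_simp
      ring
    rw [heq]
    exact mul_mem hρ hhalf

lemma exists_involution [CharZero F] [FiniteDimensional F L] (h : Module.finrank F L = 2) :
    ∃ σ : L ≃ₐ[F] L, (∀ x, σ (σ x) = x) ∧ ∀ x, σ x = x → x ∈ Set.range (algebraMap F L) := by
  have : Algebra.IsQuadraticExtension F L := { finrank_eq_two' := h }
  have hcard : Nat.card (L ≃ₐ[F] L) = 2 := by rw [IsGalois.card_aut_eq_finrank, h]
  obtain ⟨σ, hσ⟩ : ∃ σ : L ≃ₐ[F] L, σ ≠ 1 := by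
    have : Nontrivial (L ≃ₐ[F] L) := Finite.one_lt_card_iff_nontrivial.1 (by omega)
    exact exists_ne 1
  refine ⟨σ, fun x ↦ ?_, fun x hx ↦ ?_⟩
  · have h2 : σ ^ 2 = 1 := by rw [← hcard]; exact pow_card_eq_one'
    rw [sq] at h2
    exact DFunLike.congr_fun h2 x
  · refine (IsGalois.mem_range_algebraMap_iff_fixed x).2 fun τ ↦ ?_
    rcases (Nat.card_eq_two_iff' (1 : L ≃ₐ[F] L)).1 hcard with ⟨ρ, -, hρ⟩
    by_cases hτ : τ = 1
    · simp [hτ]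
    · rw [hρ τ hτ, ← hρ σ hσ, hx]

end Quadratic

section Models

variable {F : Type} [Field F] {v : F → ℤ}

lemma IsModelOf.symm {E W : WeierstrassCurve F} (h : IsModelOf E W) : IsModelOf W E := by
  obtain ⟨C, rfl⟩ := h
  exact ⟨C⁻¹, inv_smul_smul C E⟩

lemma IsModelOf.trans {E W W' : WeierstrassCurve F} (h : IsModelOf E W) (h' : IsModelOf W W') :
    IsModelOf E W' := by
  obtain ⟨C, rfl⟩ := h
  obtain ⟨C', rfl⟩ := h'
  exact ⟨C' * C, mul_smul C' C E⟩

lemma IsModelOf.baseChange {E W : WeierstrassCurve F} (h : IsModelOf E W) (L : Type) [Field L]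
    [Algebra F L] : IsModelOf (E.baseChange L) (W.baseChange L) := by
  obtain ⟨C, rfl⟩ := h
  exact ⟨C.map (algebraMap F L), E.map_variableChange C (algebraMap F L)⟩

lemma IsMinimalModel.of_isModelOf {E E' W : WeierstrassCurve F} (h : IsModelOf E E')
    (hW : IsMinimalModel v E' W) : IsMinimalModel v E W :=
  ⟨h.trans hW.1, hW.2.1, fun W' hW' ↦ hW.2.2 W' (h.symm.trans hW')⟩

lemma IsSemistable.of_isModelOf {E E' : WeierstrassCurve F} (h : IsModelOf E E')
    (hs : IsSemistable v E') : IsSemistable v E :=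
  hs.imp (fun ⟨W, hW, hΔ⟩ ↦ ⟨W, hW.of_isModelOf h, hΔ⟩) fun ⟨W, hW, hΔ⟩ ↦ ⟨W, hW.of_isModelOf h, hΔ⟩

/-- An integral model is semistable if its discriminant or its `c₄` is a unit. -/
def IsSemistableModel (v : F → ℤ) (W : WeierstrassCurve F) : Prop :=
  IsIntegralModel v W ∧ (v W.Δ = 0 ∨ W.c₄ ≠ 0 ∧ v W.c₄ = 0)

lemma IsSemistable.exists_isSemistableModel {E : WeierstrassCurve F} (h : IsSemistable v E) :
    ∃ W, IsModelOf E W ∧ IsSemistableModel v W := by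
  rcases h with ⟨W, hW, hΔ⟩ | ⟨W, hW, -, hc⟩
  · exact ⟨W, hW.1, hW.2.1, Or.inl hΔ⟩
  · exact ⟨W, hW.1, hW.2.1, Or.inr hc⟩

lemma IsIntegralModel.exists_map_eq (hv : IsNormalizedValuation v) {W : WeierstrassCurve F}
    (h : IsIntegralModel v W) : ∃ W₀ : WeierstrassCurve hv.integers,
      W₀.map hv.integers.subtype = W := by
  obtain ⟨h1, h2, h3, h4, h6⟩ := h
  exact ⟨⟨⟨_, h1⟩, ⟨_, h2⟩, ⟨_, h3⟩, ⟨_, h4⟩, ⟨_, h6⟩⟩, rfl⟩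

lemma isSemistable_of_isSemistableModel (hv : IsNormalizedValuation v) {E W : WeierstrassCurve F}
    (hEW : IsModelOf E W) (hW : IsSemistableModel v W) (hΔ : W.Δ ≠ 0) : IsSemistable v E := by
  obtain ⟨hWint, hred⟩ := hW
  have hnonneg : ∀ W' : WeierstrassCurve F, IsIntegralModel v W' →
      VIntegral v W'.Δ ∧ VIntegral v W'.c₄ := fun W' h ↦ by
    obtain ⟨W₀, rfl⟩ := h.exists_map_eq hv
    rw [map_Δ, map_c₄]
    exact ⟨W₀.Δ.2, W₀.c₄.2⟩
  have hmin : IsMinimalModel v E W := by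
    refine ⟨hEW, hWint, fun W' hEW' hW' ↦ ?_⟩
    obtain ⟨C, rfl⟩ := hEW.symm.trans hEW'
    obtain ⟨h1, h2⟩ := hnonneg _ hW'
    have hu : ((C.u⁻¹ : Fˣ) : F) ≠ 0 := Units.ne_zero _
    rw [variableChange_Δ] at h1 ⊢
    rw [variableChange_c₄] at h2
    rcases hred with h0 | ⟨hc0, hc⟩
    · rw [h0]
      exact h1.resolve_left (mul_ne_zero (pow_ne_zero _ hu) hΔ)
    · have h3 := h2.resolve_left (mul_ne_zero (pow_ne_zero _ hu) hc0)
      rw [hv.map_mul (pow_ne_zero _ hu) hc0, hv.map_pow hu, hc] at h3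
      rw [hv.map_mul (pow_ne_zero _ hu) hΔ, hv.map_pow hu]
      push_cast at h3 ⊢
      omega
  by_cases h0 : v W.Δ = 0
  · exact Or.inl ⟨W, hmin, h0⟩
  · have h1 := (hnonneg W hWint).1.resolve_left hΔ
    exact Or.inr ⟨W, hmin, by omega, hred.resolve_left h0⟩

/-- An integral model of the curve `y² = x³ + Ax + B` gives an integral model without linear terms
in `y` if `2` is a unit. -/
lemma IsIntegralModel.mem_integers_of_smul_shortCurve (hv : IsNormalizedValuation v)
    (h20 : (2 : F) ≠ 0) (hv2 : v 2 = 0) {A B : F} {C : VariableChange F}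
    (h : IsIntegralModel v (C • shortCurve A B)) :
    3 * C.r / C.u ^ 2 ∈ hv.integers ∧ (A + 3 * C.r ^ 2) / C.u ^ 4 ∈ hv.integers ∧
      (C.r ^ 3 + A * C.r + B) / C.u ^ 6 ∈ hv.integers := by
  have hhalf : (2 : F)⁻¹ ∈ hv.integers := Or.inr (by rw [hv.map_inv h20, hv2, neg_zero])
  obtain ⟨W₀, hW₀⟩ := h.exists_map_eq hv
  have hb2 : (C • shortCurve A B).b₂ ∈ hv.integers := by rw [← hW₀, map_b₂]; exact W₀.b₂.2
  have hb4 : (C • shortCurve A B).b₄ ∈ hv.integers := by rw [← hW₀, map_b₄]; exact W₀.b₄.2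
  have hb6 : (C • shortCurve A B).b₆ ∈ hv.integers := by rw [← hW₀, map_b₆]; exact W₀.b₆.2
  have hu := C.u.ne_zero
  rw [variableChange_b₂] at hb2
  rw [variableChange_b₄] at hb4
  rw [variableChange_b₆] at hb6
  simp only [b₂, b₄, b₆, shortCurve, Units.val_inv_eq_inv_val] at hb2 hb4 hb6
  refine ⟨?_, ?_, ?_⟩
  · convert mul_mem hb2 (pow_mem hhalf 2) using 1
    field_simp
    ring
  · convert mul_mem hb4 hhalf using 1
    field_simp
    ring
  · convert mul_mem hb6 (pow_mem hhalf 2) using 1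
    field_simp
    ring

lemma isIntegralModel_of_valExtends {L : Type} [Field L] [Algebra F L] {w : L → ℤ}
    (hvw : ValExtends v w) {W : WeierstrassCurve F} (h : IsIntegralModel w (W.baseChange L)) :
    IsIntegralModel v W := by
  obtain ⟨e, he, hext⟩ := hvw
  have key : ∀ x : F, VIntegral w (algebraMap F L x) → VIntegral v x := fun x hx ↦ by
    by_cases hx0 : x = 0
    · exact Or.inl hx0
    · have h1 := hx.resolve_left (by simpa using hx0)
      rw [hext x hx0] at h1
      exact Or.inr (nonneg_of_mul_nonneg_right h1 (by exact_mod_cast he))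
  exact ⟨key _ h.1, key _ h.2.1, key _ h.2.2.1, key _ h.2.2.2.1, key _ h.2.2.2.2⟩

lemma isSemistableModel_of_valExtends {L : Type} [Field L] [Algebra F L] {w : L → ℤ}
    (hvw : ValExtends v w) {W : WeierstrassCurve F} (hΔ : W.Δ ≠ 0)
    (h : IsSemistableModel w (W.baseChange L)) : IsSemistableModel v W := by
  refine ⟨isIntegralModel_of_valExtends hvw h.1, ?_⟩
  obtain ⟨e, he, hext⟩ := hvw
  have he' : (e : ℤ) ≠ 0 := by exact_mod_cast he.ne'
  have h2 := h.2
  rw [WeierstrassCurve.baseChange, map_Δ, map_c₄, hext _ hΔ] at h2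
  refine h2.imp (fun h0 ↦ (mul_eq_zero.1 h0).resolve_left he') fun ⟨hc, h0⟩ ↦ ?_
  have hc' : W.c₄ ≠ 0 := fun h ↦ hc (by rw [h, map_zero])
  rw [hext _ hc'] at h0
  exact ⟨hc', (mul_eq_zero.1 h0).resolve_left he'⟩

lemma shortCurve_twist_Δ (A B d : F) :
    (shortCurve (d ^ 2 * A) (d ^ 3 * B)).Δ = d ^ 6 * (shortCurve A B).Δ := by
  simp only [shortCurve, Δ, b₂, b₄, b₆, b₈]
  ring

lemma shortCurve_twist_c₄ (A B d : F) :
    (shortCurve (d ^ 2 * A) (d ^ 3 * B)).c₄ = d ^ 2 * (shortCurve A B).c₄ := by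
  simp only [shortCurve, c₄, b₂, b₄]
  ring

/-- Let `C` transform `y² = x³ + Ax + B` into a semistable model. Then every change of variables
whose scaling has the same valuation as that of `C` and whose translation differs from that of `C`
by an integral amount transforms the quadratic twist by `d` into a semistable model. -/
lemma isSemistableModel_smul_twist (hv : IsNormalizedValuation v) (h20 : (2 : F) ≠ 0)
    (hv2 : v 2 = 0) {A B d r : F} (hd : d ≠ 0) {u : Fˣ} {C : VariableChange F}
    (hΔ : (shortCurve A B).Δ ≠ 0) (hC : IsSemistableModel v (C • shortCurve A B))
    (hu : 2 * v u = 2 * v C.u + v d) (hr : (r - C.r) / C.u ^ 2 ∈ hv.integers) :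
    IsSemistableModel v
      ((⟨u, d * r, 0, 0⟩ : VariableChange F) • shortCurve (d ^ 2 * A) (d ^ 3 * B)) := by
  obtain ⟨h2, h4, h6⟩ := hC.1.mem_integers_of_smul_shortCurve hv h20 hv2
  have hCu := C.u.ne_zero
  have hu0 := u.ne_zero
  have hq0 : d * C.u ^ 2 / u ^ 2 ≠ 0 := by positivity
  have hq : v (d * C.u ^ 2 / u ^ 2) = 0 := by
    rw [hv.map_div (mul_ne_zero hd (pow_ne_zero 2 hCu)) (pow_ne_zero 2 hu0),
      hv.map_mul hd (pow_ne_zero 2 hCu), hv.map_pow hCu, hv.map_pow hu0]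
    push_cast
    omega
  have hqi : d * C.u ^ 2 / u ^ 2 ∈ hv.integers := Or.inr hq.ge
  have hscale : ∀ (n : ℕ) {x : F}, x ≠ 0 → v ((d * C.u ^ 2 / u ^ 2) ^ n * x) = v x :=
    fun n x hx ↦ by rw [hv.map_mul (pow_ne_zero n hq0) hx, hv.map_pow hq0, hq]; ring
  set ρ := (r - C.r) / (C.u : F) ^ 2 with hρ
  have hreq : r = C.r + C.u ^ 2 * ρ := by
    rw [hρ]
    field_simp
    ring
  refine ⟨⟨Or.inl ?_, ?_, Or.inl ?_, ?_, ?_⟩, ?_⟩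
  · simp [variableChange_a₁, shortCurve]
  · rw [← hv.mem_integers]
    convert mul_mem hqi (add_mem h2 (mul_mem (ofNat_mem hv.integers 3) hr)) using 1
    simp only [variableChange_a₂, shortCurve, Units.val_inv_eq_inv_val]
    rw [hreq]
    field_simp
    ring
  · simp [variableChange_a₃, shortCurve]
  · rw [← hv.mem_integers]
    convert mul_mem (pow_mem hqi 2) (add_mem h4 (add_mem
      (mul_mem (ofNat_mem hv.integers 2) (mul_mem h2 hr))
      (mul_mem (ofNat_mem hv.integers 3) (pow_mem hr 2)))) using 1
    simp only [variableChange_a₄, shortCurve, Units.val_inv_eq_inv_val]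
    rw [hreq]
    field_simp
    ring
  · rw [← hv.mem_integers]
    convert mul_mem (pow_mem hqi 3) (add_mem h6 (add_mem (mul_mem h4 hr) (add_mem
      (mul_mem h2 (pow_mem hr 2)) (pow_mem hr 3)))) using 1
    simp only [variableChange_a₆, shortCurve, Units.val_inv_eq_inv_val]
    rw [hreq]
    field_simp
    ring
  · have hΔeq : ((⟨u, d * r, 0, 0⟩ : VariableChange F) • shortCurve (d ^ 2 * A) (d ^ 3 * B)).Δ =
        (d * C.u ^ 2 / u ^ 2) ^ 6 * (C • shortCurve A B).Δ := by
      rw [variableChange_Δ, variableChange_Δ, shortCurve_twist_Δ]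
      simp only [Units.val_inv_eq_inv_val]
      field_simp
    have hc₄eq : ((⟨u, d * r, 0, 0⟩ : VariableChange F) •
        shortCurve (d ^ 2 * A) (d ^ 3 * B)).c₄ =
        (d * C.u ^ 2 / u ^ 2) ^ 2 * (C • shortCurve A B).c₄ := by
      rw [variableChange_c₄, variableChange_c₄, shortCurve_twist_c₄]
      simp only [Units.val_inv_eq_inv_val]
      field_simp
    have hΔC : (C • shortCurve A B).Δ ≠ 0 := by
      rw [variableChange_Δ]
      exact mul_ne_zero (pow_ne_zero _ (Units.ne_zero _)) hΔ
    rw [hΔeq, hc₄eq, hscale 6 hΔC]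
    refine hC.2.imp_right fun ⟨hc0, hc⟩ ↦ ⟨mul_ne_zero (pow_ne_zero 2 hq0) hc0, ?_⟩
    rw [hscale 2 hc0, hc]

end Models

section Descent

variable {F L : Type} [Field F] [Field L] [Algebra F L] {v : F → ℤ} {w : L → ℤ}

lemma shortCurve_baseChange (A B : F) :
    (shortCurve A B).baseChange L = shortCurve (algebraMap F L A) (algebraMap F L B) := by
  simp [shortCurve, WeierstrassCurve.baseChange, WeierstrassCurve.map]

lemma exists_isModelOf_shortCurve [CharZero F] (E : WeierstrassCurve F) :
    ∃ A B : F, IsModelOf E (shortCurve A B) := by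
  let _ : Invertible (2 : F) := invertibleOfNonzero two_ne_zero
  let _ : Invertible (3 : F) := invertibleOfNonzero three_ne_zero
  obtain ⟨C, hC⟩ := E.exists_variableChange_isShortNF
  refine ⟨(C • E).a₄, (C • E).a₆, C, ?_⟩
  ext
  · exact hC.a₁
  · exact hC.a₂
  · exact hC.a₃
  · rfl
  · rfl

/-- If `y² = x³ + Ax + B` is semistable over a quadratic extension, then its quadratic twist by
`d` is semistable, where `d` is either `1` or any given uniformizer. -/
lemma exists_isSemistable_twist [CharZero F] [FiniteDimensional F L]
    (hquad : Module.finrank F L = 2) (hv : IsNormalizedValuation v)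
    (hw : IsNormalizedValuation w) (hvw : ValExtends v w) (hv2 : v 2 = 0) {A B π : F}
    (hΔ : (shortCurve A B).Δ ≠ 0) (hπ : π ≠ 0) (hvπ : v π = 1)
    (hs : IsSemistable w ((shortCurve A B).baseChange L)) :
    ∃ d : F, (d = 1 ∨ d = π) ∧ IsSemistable v (shortCurve (d ^ 2 * A) (d ^ 3 * B)) := by
  have hL20 : (2 : L) ≠ 0 := by
    rw [← map_ofNat (algebraMap F L) 2]
    simp
  have hw2 : w 2 = 0 := by
    obtain ⟨e, -, hext⟩ := hvw
    rw [← map_ofNat (algebraMap F L) 2, hext _ two_ne_zero, hv2, mul_zero]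
  obtain ⟨W, ⟨C, rfl⟩, hW⟩ := hs.exists_isSemistableModel
  rw [shortCurve_baseChange] at hW
  obtain ⟨h2, h4, h6⟩ := hW.1.mem_integers_of_smul_shortCurve hw hL20 hw2
  obtain ⟨σ, hσ, hfix⟩ := exists_involution (F := F) (L := L) hquad
  obtain ⟨r, D, hD0, hD, hr⟩ :=
    exists_descended_change hw hw2 hL20 σ hσ hfix A B C.u.ne_zero h2 h4 h6
  obtain ⟨d, u, hd, hd0, hu⟩ : ∃ (d : F) (u : Fˣ), (d = 1 ∨ d = π) ∧ d ≠ 0 ∧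
      2 * v u = v D + v d := by
    obtain ⟨x, hx, hxv⟩ := hv.exists_eq ((v D + 1) / 2)
    rcases Int.even_or_odd (v D) with heven | hodd
    · exact ⟨1, Units.mk0 x hx, Or.inl rfl, one_ne_zero, by
        rw [Units.val_mk0, hxv, hv.map_one]; grind⟩
    · exact ⟨π, Units.mk0 x hx, Or.inr rfl, hπ, by
        rw [Units.val_mk0, hxv, hvπ]; grind⟩
  refine ⟨d, hd, ?_⟩
  have hΔd : (shortCurve (d ^ 2 * A) (d ^ 3 * B)).Δ ≠ 0 := by
    rw [shortCurve_twist_Δ]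
    exact mul_ne_zero (pow_ne_zero 6 hd0) hΔ
  let C' : VariableChange F := ⟨u, d * r, 0, 0⟩
  have hΔ' : (C' • shortCurve (d ^ 2 * A) (d ^ 3 * B)).Δ ≠ 0 := by
    rw [variableChange_Δ]
    exact mul_ne_zero (pow_ne_zero _ (Units.ne_zero _)) hΔd
  refine isSemistable_of_isSemistableModel hv ⟨C', rfl⟩
    (isSemistableModel_of_valExtends hvw hΔ' ?_) hΔ'
  have hΔL : (shortCurve (algebraMap F L A) (algebraMap F L B)).Δ ≠ 0 := by
    rw [← shortCurve_baseChange, WeierstrassCurve.baseChange, map_Δ]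
    simpa using hΔ
  have hval : 2 * w (Units.map (algebraMap F L : F →* L) u) =
      2 * w C.u + w (algebraMap F L d) := by
    obtain ⟨e, -, hext⟩ := hvw
    rw [← hD, hext D hD0, hext d hd0, Units.coe_map, MonoidHom.coe_coe, hext _ u.ne_zero]
    linear_combination (e : ℤ) * hu
  have key := isSemistableModel_smul_twist hw hL20 hw2 (by simpa using hd0) hΔL hW hval hr
  convert key using 1
  rw [WeierstrassCurve.baseChange, ← map_variableChange, ← WeierstrassCurve.baseChange,
    shortCurve_baseChange]
  simp [C', VariableChange.map]

end Descent

/-- Let `F` be a `p`-adic local field with odd residue characteristic `p ≥ 3`, and let `E` be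
an elliptic curve over `F` which becomes semistable over some quadratic extension of `F`. Then
`E` is semistable over `F`, or the quadratic twist of `E` by a uniformizer of `F` is semistable
over `F`. -/
theorem semistable_or_uniformizer_twist_semistable_of_quadratic_semistable
    (p : ℕ) [Fact p.Prime] (hp3 : 3 ≤ p)
    (F : Type) [Field F] [Algebra ℚ_[p] F] [FiniteDimensional ℚ_[p] F]
    (v : F → ℤ) (hv : IsNormalizedValuation v) (hres : 0 < v ((p : ℕ) : F))
    (E : WeierstrassCurve F) [E.IsElliptic]
    (hquad : ∃ (L : Type) (_ : Field L) (_ : Algebra F L) (_ : FiniteDimensional F L),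
      Module.finrank F L = 2 ∧ ∃ w : L → ℤ, IsNormalizedValuation w ∧ ValExtends v w ∧
        IsSemistable w (E.baseChange L)) :
    IsSemistable v E ∨
      ∃ π : F, π ≠ 0 ∧ v π = 1 ∧ ∃ E' : WeierstrassCurve F,
        IsQuadraticTwistOf E' E π ∧ IsSemistable v E' := by
  have : CharZero F := charZero_of_injective_algebraMap (algebraMap ℚ_[p] F).injective
  have hp : Odd p := (Fact.out : p.Prime).odd_of_ne_two (by omega)
  obtain ⟨π, hπ, hvπ⟩ := hv.exists_uniformizer
  obtain ⟨L, _, _, _, hL, w, hw, hvw, hs⟩ := hquad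
  obtain ⟨A, B, hAB⟩ := exists_isModelOf_shortCurve E
  have hΔ : (shortCurve A B).Δ ≠ 0 := by
    obtain ⟨C, hC⟩ := hAB
    rw [← hC]
    exact (C • E).isUnit_Δ.ne_zero
  obtain ⟨d, rfl | rfl, hd⟩ := exists_isSemistable_twist hL hv hw hvw (hv.map_two hp hres) hΔ hπ hvπ
    (hs.of_isModelOf (hAB.baseChange L).symm)
  · rw [one_pow, one_pow, one_mul, one_mul] at hd
    exact Or.inl (hd.of_isModelOf hAB)
  · exact Or.inr ⟨d, hπ, hvπ, _, ⟨A, B, hAB, 1, one_smul _ _⟩, hd⟩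

end
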